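/- For all i, j ∈ ℕ₀ and each τ ∈ {−1, 1}, the function t ↦ f_{i,j}(τ(1−t)), defined on (0,2), belongs to the class Q_{−1, (i+j)/2}. -/

import Mathlib

open MeasureTheory ProbabilityTheory Filter Set

noncomputable section

/-- The standard Gaussian measure `N(0,1)` on `ℝ`. -/
def stdGaussian : Measure ℝ := gaussianReal 0 1

/-- The `n`-th normalized probabilists' Hermite polynomial as a function `ℝ → ℝ`. -/
def hermiteFun (n : ℕ) (x : ℝ) : ℝ :=
  (Polynomial.aeval x (Polynomial.hermite n)) / Real.sqrt (n.factorial)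

/-- The `n`-th Hermite coefficient `a_n(f) = ∫ f · h_n dγ`. -/
def hermiteCoeff (f : ℝ → ℝ) (n : ℕ) : ℝ :=
  ∫ x, f x * hermiteFun n x ∂stdGaussian

/-- The reference activation `s_k(x) = sgn(x) x^k / (2 k!)`. -/
def refAct (k : ℕ) (x : ℝ) : ℝ := Real.sign x * x ^ k / (2 * k.factorial)

/-- The mix term `f_{i,j}(t) = Σ_n a_n(s_i) a_n(s_j) t^n`. -/
def mixTerm (i j : ℕ) (t : ℝ) : ℝ :=
  ∑' n : ℕ, hermiteCoeff (refAct i) n * hermiteCoeff (refAct j) n * t ^ n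

/-- `P_{α,β}`: finite sums of real powers `t^{α_i}` on `(0,2)`, where integer exponents
exceed `α` and non-integer exponents exceed `β`. -/
def Pclass (α β : ℝ) : Set (ℝ → ℝ) :=
  { f | ∃ (n : ℕ) (a : Fin n → ℝ) (e : Fin n → ℝ),
      (∀ i, (∃ z : ℤ, e i = (z : ℝ)) → α < e i) ∧
      (∀ i, (¬ ∃ z : ℤ, e i = (z : ℝ)) → β < e i) ∧
      (∀ t ∈ Set.Ioo (0 : ℝ) 2, f t = ∑ i, a i * t ^ (e i)) }

/-- `R_{γ'}`: functions that are `C^∞` on `(0,2)` and whose `m`-th derivatives are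
`O(t^{γ'-m})` as `t ↓ 0`. -/
def Rclass (γ' : ℝ) : Set (ℝ → ℝ) :=
  { f | ContDiffOn ℝ (⊤ : ℕ∞) f (Set.Ioo (0 : ℝ) 2) ∧
      ∀ m : ℕ, ∃ C : ℝ, ∃ ε > (0 : ℝ), ∀ t ∈ Set.Ioo (0 : ℝ) (min ε 2),
        |iteratedDerivWithin m f (Set.Ioo (0 : ℝ) 2) t| ≤ C * t ^ (γ' - m) }

/-- `Q_{α,β} = ∩_{γ'} (P_{α,β} + R_{γ'})` (as functions on `(0,2)`). -/
def Qclass (α β : ℝ) : Set (ℝ → ℝ) :=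
  { f | ∀ γ' : ℝ, ∃ p ∈ Pclass α β, ∃ r ∈ Rclass γ',
      ∀ t ∈ Set.Ioo (0 : ℝ) 2, f t = p t + r t }



/-- Gaussian weight integrability of polynomials. -/
lemma aux_integrable (p : Polynomial ℝ) :
    Integrable (fun x : ℝ => p.eval x * Real.exp (-(1/2) * x ^ 2)) := by
  induction p using Polynomial.induction_on' with
  | add p q hp hq =>
    refine (hp.add hq).congr (Eventually.of_forall fun x => ?_)
    simp [add_mul]
  | monomial n a =>
    have h := (integrable_rpow_mul_exp_neg_mul_sq (b := 1/2) (by norm_num) (s := n)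
      (by have : (0:ℝ) ≤ n := n.cast_nonneg
          linarith)).const_mul a
    simpa [mul_assoc] using h

lemma aux_sign_meas : Measurable Real.sign := by
  unfold Real.sign
  refine Measurable.ite measurableSet_Iio measurable_const ?_
  exact Measurable.ite measurableSet_Ioi measurable_const measurable_const

lemma aux_sign_le (x : ℝ) : ‖Real.sign x‖ ≤ 1 := by
  rcases Real.sign_apply_eq x with h | h | h <;> simp [h]

lemma aux_sign_integrable {f : ℝ → ℝ} (hf : Integrable f) :
    Integrable (fun x => Real.sign x * f x) :=
  hf.bdd_mul aux_sign_meas.aestronglyMeasurable (Eventually.of_forall aux_sign_le)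

/-- The functional `p ↦ ∫ sgn(x) p(x) exp(-x^2/2) dx`. -/
def Lfun (p : Polynomial ℝ) : ℝ :=
  ∫ x : ℝ, Real.sign x * (p.eval x * Real.exp (-(1/2) * x ^ 2))

lemma Lfun_add (p q : Polynomial ℝ) : Lfun (p + q) = Lfun p + Lfun q := by
  unfold Lfun
  rw [← integral_add (aux_sign_integrable (aux_integrable p))
    (aux_sign_integrable (aux_integrable q))]
  congr 1; ext x; simp; ring

lemma Lfun_smul (a : ℝ) (p : Polynomial ℝ) : Lfun (Polynomial.C a * p) = a * Lfun p := by
  unfold Lfun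
  rw [← integral_const_mul]
  congr 1; ext x; simp; ring

lemma Lfun_ibp (q : Polynomial ℝ) (hq : q.eval 0 = 0) :
    Lfun (Polynomial.derivative q - Polynomial.X * q) = 0 := by
  set g : ℝ → ℝ := fun x => q.eval x * Real.exp (-(1/2) * x ^ 2) with hg
  set g' : ℝ → ℝ := fun x => (Polynomial.derivative q - Polynomial.X * q).eval x
    * Real.exp (-(1/2) * x ^ 2) with hg'
  have hd : ∀ x, HasDerivAt g (g' x) x := by
    intro x
    have h1 := q.hasDerivAt x
    have h2 : HasDerivAt (fun x : ℝ => Real.exp (-(1/2) * x ^ 2))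
        (Real.exp (-(1/2) * x ^ 2) * (-(1/2) * (2 * x))) x := by
      simpa using (((hasDerivAt_id x).pow 2).const_mul (-(1/2) : ℝ)).exp
    refine (h1.mul h2).congr_deriv ?_
    simp [hg']; ring
  have hi : Integrable g := aux_integrable _
  have hi' : Integrable g' := aux_integrable _
  have e1 : ∫ x in Ioi (0:ℝ), g' x = 0 := by
    rw [integral_Ioi_of_hasDerivAt_of_tendsto' (fun x _ => hd x) hi'.integrableOn
      (tendsto_zero_of_hasDerivAt_of_integrableOn_Ioi (fun x _ => hd x) hi'.integrableOn
        hi.integrableOn (a := 0))]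
    simp [hg, hq]
  have e2 : ∫ x in Iic (0:ℝ), g' x = 0 := by
    rw [integral_Iic_of_hasDerivAt_of_tendsto' (fun x _ => hd x) hi'.integrableOn
      (tendsto_zero_of_hasDerivAt_of_integrableOn_Iic (fun x _ => hd x) hi'.integrableOn
        hi.integrableOn (a := 0))]
    simp [hg, hq]
  change ∫ x : ℝ, Real.sign x * g' x = 0
  rw [← integral_add_compl measurableSet_Iic (aux_sign_integrable hi') (s := Iic (0:ℝ)),
    compl_Iic, integral_Iic_eq_integral_Iio]
  rw [integral_Iic_eq_integral_Iio] at e2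
  have e3 : ∫ x in Ioi (0:ℝ), Real.sign x * g' x = ∫ x in Ioi (0:ℝ), g' x :=
    setIntegral_congr_fun measurableSet_Ioi (fun x hx => by simp [Real.sign_of_pos hx])
  have e4 : ∫ x in Iio (0:ℝ), Real.sign x * g' x = ∫ x in Iio (0:ℝ), - g' x :=
    setIntegral_congr_fun measurableSet_Iio (fun x hx => by simp [Real.sign_of_neg hx])
  rw [e3, e4, integral_neg, e1, e2]; simp

/-- Real Hermite polynomial. -/
def Hr (n : ℕ) : Polynomial ℝ := (Polynomial.hermite n).map (Int.castRingHom ℝ)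

lemma Hr_zero : Hr 0 = 1 := by simp [Hr]

lemma Hr_succ (n : ℕ) : Hr (n+1) = Polynomial.X * Hr n - Polynomial.derivative (Hr n) := by
  simp [Hr, Polynomial.hermite_succ, Polynomial.derivative_map]

lemma Hr_deriv (n : ℕ) : Polynomial.derivative (Hr (n+1)) = ((n : Polynomial ℝ)+1) * Hr n := by
  induction n with
  | zero => simp [Hr_succ, Hr_zero]
  | succ n ih =>
    rw [Hr_succ (n+1), Polynomial.derivative_sub, Polynomial.derivative_mul, ih]
    have : Polynomial.derivative (((n : Polynomial ℝ)+1) * Hr n)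
       = ((n : Polynomial ℝ)+1) * Polynomial.derivative (Hr n) := by
      simp [Polynomial.derivative_mul]
    rw [this, Hr_succ n]; simp; ring

lemma Hr_parity (n : ℕ) (x : ℝ) : (Hr n).eval (-x) = (-1)^n * (Hr n).eval x := by
  have h : ∀ n : ℕ, (Hr n).comp (-Polynomial.X) = (-1)^n * Hr n := by
    intro n
    induction n with
    | zero => simp [Hr_zero]
    | succ n ih =>
      have h2 := congrArg Polynomial.derivative ih
      have hc : Polynomial.derivative ((-1:Polynomial ℝ)^n) = 0 := by
        have : ((-1:Polynomial ℝ)^n) = Polynomial.C ((-1)^n) := by simp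
        rw [this, Polynomial.derivative_C]
      rw [Polynomial.derivative_comp, Polynomial.derivative_mul, hc] at h2
      simp at h2
      rw [Hr_succ, Polynomial.sub_comp, Polynomial.mul_comp, ih, Polynomial.X_comp]
      have h3 : (Polynomial.derivative (Hr n)).comp (-Polynomial.X)
        = - ((-1)^n * Polynomial.derivative (Hr n)) := by rw [← h2]; simp
      rw [h3]; ring
  have := congrArg (Polynomial.eval x) (h n)
  simpa using this

/-- Unnormalised coefficients. -/
def Mc (k n : ℕ) : ℝ := Lfun (Polynomial.X ^ k * Hr n)

lemma Mc_one (k n : ℕ) : Mc (k+1) (n+1) = ((k:ℝ)+1) * Mc k n := by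
  have h := Lfun_ibp (Polynomial.X ^ (k+1) * Hr n) (by simp)
  have e : Polynomial.derivative (Polynomial.X ^ (k+1) * Hr n)
      - Polynomial.X * (Polynomial.X ^ (k+1) * Hr n)
      = Polynomial.C ((k:ℝ)+1) * (Polynomial.X ^ k * Hr n)
        + Polynomial.C (-1) * (Polynomial.X ^ (k+1) * Hr (n+1)) := by
    rw [Polynomial.derivative_mul, Hr_succ, Polynomial.derivative_X_pow]
    simp; ring
  rw [e, Lfun_add, Lfun_smul, Lfun_smul] at h
  unfold Mc; linarith

lemma Mc_two (k n : ℕ) : ((k:ℝ)+1) * ((k:ℝ)+2) * Mc k n = ((k:ℝ)+2-n) * Mc (k+2) n := by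
  have h1 := Mc_one k n
  cases n with
  | zero =>
    have : Mc (k+1) 1 = Mc (k+2) 0 := by
      unfold Mc; congr 1; simp [Hr_succ, Hr_zero]; ring
    simp at h1 ⊢; rw [← this, h1]; ring
  | succ n =>
    have h2 := Mc_one (k+1) n
    have h3 : Mc (k+1) (n+1+1) = Mc (k+2) (n+1) + (-((n:ℝ)+1)) * Mc (k+1) n := by
      unfold Mc
      rw [← Lfun_smul, ← Lfun_add]; congr 1
      rw [Hr_succ (n+1), Hr_deriv]; simp; ring
    rw [h3] at h1
    push_cast at *
    have h4 : Mc (k+1+1) (n+1) = Mc (k+2) (n+1) := rfl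
    rw [h4] at h2
    linear_combination (-(k:ℝ)-2) * h1 + ((n:ℝ)+1) * h2

lemma Mc_parity (k n : ℕ) (h : Even (k + n)) : Mc k n = 0 := by
  unfold Mc Lfun
  set f : ℝ → ℝ := fun x => Real.sign x * ((Polynomial.X ^ k * Hr n).eval x
    * Real.exp (-(1/2) * x ^ 2)) with hf
  have h1 : ∀ x, f (-x) = - f x := by
    intro x
    have : ((-1:ℝ))^k * (-1)^n = 1 := by rw [← pow_add]; exact h.neg_one_pow
    simp only [hf, Polynomial.eval_mul, Polynomial.eval_pow, Polynomial.eval_X, Hr_parity,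
      Real.sign_neg, neg_sq]
    rw [neg_pow x k]
    linear_combination (-(Real.sign x * x^k * (Hr n).eval x * Real.exp (-(1/2) * x ^ 2))) * this
  have h2 := integral_neg_eq_self f volume
  simp_rw [h1] at h2
  rw [integral_neg] at h2
  linarith

/-- hermite coefficient of the reference activation -/
lemma coeff_eq (k n : ℕ) : hermiteCoeff (refAct k) n =
    (Real.sqrt (2 * Real.pi))⁻¹ / (2 * k.factorial) / Real.sqrt n.factorial * Mc k n := by
  unfold hermiteCoeff _root_.stdGaussian Mc Lfun
  rw [integral_gaussianReal_eq_integral_smul (by norm_num), ← integral_const_mul]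
  congr 1; ext x
  have : (Polynomial.aeval x) (Polynomial.hermite n) = (Hr n).eval x := by
    simp [Hr, Polynomial.eval_map, Polynomial.aeval_def]
  simp only [gaussianPDFReal, refAct, hermiteFun, this]
  simp
  have e : -x^2/2 = -(2⁻¹ * x^2) := by ring
  rw [e]; ring

/-- Abbreviation. -/
def uc (k n : ℕ) : ℝ := hermiteCoeff (refAct k) n

lemma uc_one (k n : ℕ) : Real.sqrt (n+1) * uc (k+1) (n+1) = uc k n := by
  unfold uc
  rw [coeff_eq, coeff_eq, Mc_one, Nat.factorial_succ, Nat.factorial_succ]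
  push_cast
  rw [Real.sqrt_mul (by positivity : (0:ℝ) ≤ (n:ℝ)+1)]
  have h1 : Real.sqrt ((n:ℝ)+1) ≠ 0 := by positivity
  have h2 : Real.sqrt (n.factorial:ℝ) ≠ 0 := by positivity
  field_simp

lemma uc_two (k n : ℕ) : uc k n = ((k:ℝ)+2-n) * uc (k+2) n := by
  unfold uc
  rw [coeff_eq, coeff_eq, Nat.factorial_succ, Nat.factorial_succ]
  push_cast
  have h2 : Real.sqrt (n.factorial:ℝ) ≠ 0 := by positivity
  have := Mc_two k n
  field_simp
  linear_combination this

lemma uc_parity (k n : ℕ) (h : Even (k + n)) : uc k n = 0 := by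
  unfold uc; rw [coeff_eq, Mc_parity k n h]; simp

lemma uc_rec (k n : ℕ) :
    Real.sqrt (n+1) * Real.sqrt (n+2) * uc k (n+2) = ((k:ℝ) - n) * uc k n := by
  have h1 := uc_one (k+1) (n+1)
  have h2 := uc_one k n
  have h3 := uc_two k (n+2)
  push_cast at h1 h3
  have e : (n:ℝ)+1+1 = n+2 := by ring
  rw [e] at h1
  have h1' : Real.sqrt (n+2) * uc (k+2) (n+2) = uc (k+1) (n+1) := h1
  rw [h3, ← h2, ← h1']; ring

lemma uc_bdd (k : ℕ) : ∃ K : ℝ, ∀ n, |uc k n| ≤ K := by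
  refine ⟨∑ m ∈ Finset.range (k+2), |uc k m|, fun n => ?_⟩
  induction n using Nat.strong_induction_on with
  | _ n ih =>
    by_cases hn : n < k + 2
    · exact Finset.single_le_sum (f := fun m => |uc k m|) (fun i _ => abs_nonneg _)
        (Finset.mem_range.2 hn)
    · obtain ⟨m, rfl⟩ : ∃ m, n = m + 2 := ⟨n - 2, by omega⟩
      refine le_trans ?_ (ih m (by omega))
      have hr := congrArg abs (uc_rec k m)
      rw [abs_mul, abs_mul (_ - _), abs_of_nonneg (by positivity :
        (0:ℝ) ≤ Real.sqrt (m+1) * Real.sqrt (m+2))] at hr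
      have hkm : (k:ℝ) ≤ m := by exact_mod_cast (by omega : k ≤ m)
      have h0 : (0:ℝ) ≤ k := k.cast_nonneg
      rw [abs_of_nonpos (by linarith : (k:ℝ) - m ≤ 0)] at hr
      have hs : (m:ℝ)+1 ≤ Real.sqrt (m+1) * Real.sqrt (m+2) := by
        rw [← Real.sqrt_mul (by positivity)]
        apply Real.le_sqrt_of_sq_le; nlinarith
      have h5 : ((m:ℝ)+1) * |uc k (m+2)| ≤ (m+1) * |uc k m| := by
        calc ((m:ℝ)+1) * |uc k (m+2)| ≤ Real.sqrt (m+1) * Real.sqrt (m+2) * |uc k (m+2)| := by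
              gcongr
          _ = -((k:ℝ) - m) * |uc k m| := hr
          _ ≤ _ := by gcongr; linarith
      exact le_of_mul_le_mul_left h5 (by linarith)


/-- `c` has radius of convergence at least `R`. -/
def PS (c : ℕ → ℝ) (R : ℝ) : Prop := ∀ r : ℝ, 0 ≤ r → r < R → Summable (fun n => |c n| * r ^ n)

/-- Sum of the power series. -/
def Ssum (c : ℕ → ℝ) (x : ℝ) : ℝ := ∑' n, c n * x ^ n

/-- Coefficients of the derivative. -/
def Dc (c : ℕ → ℝ) (n : ℕ) : ℝ := ((n:ℝ) + 1) * c (n + 1)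

/-- Coefficients of `x f'`. -/
def Tc (c : ℕ → ℝ) (n : ℕ) : ℝ := (n:ℝ) * c n

lemma PS.summable {c : ℕ → ℝ} {R x : ℝ} (h : PS c R) (hx : |x| < R) :
    Summable (fun n => c n * x ^ n) := by
  refine Summable.of_norm ?_
  simpa [abs_mul, abs_pow] using h |x| (abs_nonneg x) hx

lemma PS.of_le {c d : ℕ → ℝ} {R : ℝ} (h : PS c R) (K : ℝ) (hd : ∀ n, |d n| ≤ K * |c n|) :
    PS d R := by
  intro r h0 h1
  refine Summable.of_nonneg_of_le (fun n => by positivity) (fun n => ?_) ((h r h0 h1).mul_left K)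
  rw [← mul_assoc]
  exact mul_le_mul_of_nonneg_right (hd n) (by positivity)

lemma PS.theta {c : ℕ → ℝ} {R : ℝ} (h : PS c R) : PS (Tc c) R := by
  intro r h0 h1
  obtain ⟨q, hq1, hq2⟩ := exists_between h1
  have hq : 0 < q := lt_of_le_of_lt h0 hq1
  have hs := h q hq.le hq2
  obtain ⟨K, hK⟩ := hs.tendsto_atTop_zero.bddAbove_range
  have hlt : r / q < 1 := (div_lt_one hq).2 hq1
  have hgeo := (summable_pow_mul_geometric_of_norm_lt_one 1 (r := r / q)
    (by rw [Real.norm_eq_abs, abs_of_nonneg (by positivity)]; exact hlt)).mul_left K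
  refine Summable.of_nonneg_of_le (fun n => by positivity) (fun n => ?_) hgeo
  have hKn : |c n| * q ^ n ≤ K := hK ⟨n, rfl⟩
  have e : |Tc c n| * r ^ n = (|c n| * q^n) * ((n:ℝ)^1 * (r/q)^n) := by
    simp only [Tc, abs_mul, Nat.abs_cast, div_pow]
    field_simp
  rw [e]
  exact mul_le_mul_of_nonneg_right hKn (by positivity)

lemma PS.deriv_coeff {c : ℕ → ℝ} {R : ℝ} (h : PS c R) : PS (Dc c) R := by
  intro r h0 h1
  obtain ⟨q, hq1, hq2⟩ := exists_between h1
  have hq : 0 < q := lt_of_le_of_lt h0 hq1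
  have h2 := ((summable_nat_add_iff 1).2 (h.theta q hq.le hq2)).mul_left q⁻¹
  refine Summable.of_nonneg_of_le (fun n => by positivity) (fun n => ?_) h2
  have e : q⁻¹ * (|Tc c (n+1)| * q^(n+1)) = |Dc c n| * q^n := by
    simp only [Tc, Dc]; push_cast; rw [pow_succ]; field_simp
  rw [e]
  gcongr

lemma Ssum_theta {c : ℕ → ℝ} {R x : ℝ} (h : PS c R) (hx : |x| < R) :
    Ssum (Tc c) x = x * Ssum (Dc c) x := by
  unfold Ssum
  rw [(h.theta.summable hx).tsum_eq_zero_add, ← tsum_mul_left]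
  simp only [Tc, Dc]
  simp
  congr 1; ext n; ring

lemma PS.hasDerivAt {c : ℕ → ℝ} {R x : ℝ} (h : PS c R) (hx : |x| < R) :
    HasDerivAt (Ssum c) (Ssum (Dc c) x) x := by
  obtain ⟨q, hq1, hq2⟩ := exists_between hx
  have hq : 0 < q := lt_of_le_of_lt (abs_nonneg x) hq1
  have hu : Summable (fun n : ℕ => |c n| * ((n:ℝ) * q ^ (n-1))) := by
    rw [← summable_nat_add_iff 1]
    refine (h.deriv_coeff q hq.le hq2).congr (fun n => ?_)
    simp only [Dc, abs_mul]
    rw [abs_of_nonneg (by positivity : (0:ℝ) ≤ (n:ℝ)+1)]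
    simp; ring
  have key := hasDerivAt_tsum_of_isPreconnected (𝕜 := ℝ) (F := ℝ)
    (g := fun n y => c n * y ^ n) (g' := fun n y => c n * ((n:ℝ) * y ^ (n-1)))
    (t := Metric.ball (0:ℝ) q) (y₀ := 0) (y := x) hu Metric.isOpen_ball
    (convex_ball _ _).isPreconnected
    (fun n y _ => (hasDerivAt_pow n y).const_mul (c n))
    (fun n y hy => by
      have hy' : |y| ≤ q := by simpa using (mem_ball_zero_iff.1 hy).le
      simp only [norm_mul, Real.norm_eq_abs, abs_pow, Nat.abs_cast]
      gcongr)
    (by simpa using hq) (h.summable (by simpa using hq.trans hq2))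
    (by simpa using hq1)
  refine key.congr_deriv ?_
  have hs : Summable (fun n : ℕ => c n * ((n:ℝ) * x ^ (n-1))) := by
    refine Summable.of_norm_bounded hu (fun n => ?_)
    simp only [norm_mul, Real.norm_eq_abs, abs_pow, Nat.abs_cast]
    gcongr
  rw [hs.tsum_eq_zero_add]
  simp [Ssum, Dc]
  congr 1; ext n; ring

open scoped ENNReal NNReal in
lemma PS.analyticAt {c : ℕ → ℝ} {R x : ℝ} (h : PS c R) (hx : |x| < R) :
    AnalyticAt ℝ (Ssum c) x := by
  obtain ⟨q, hq1, hq2⟩ := exists_between hx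
  have hq : 0 < q := lt_of_le_of_lt (abs_nonneg x) hq1
  set p := FormalMultilinearSeries.ofScalars ℝ c with hp
  lift q to ℝ≥0 using hq.le
  have hr : (q : ℝ≥0∞) ≤ p.radius := by
    apply FormalMultilinearSeries.le_radius_of_summable
    refine (h q hq.le hq2).congr (fun n => ?_)
    rw [hp, FormalMultilinearSeries.ofScalars_norm]; rfl
  have hpos : 0 < p.radius := lt_of_lt_of_le (by exact_mod_cast hq) hr
  have hf := p.hasFPowerSeriesOnBall hpos
  have hs : p.sum = Ssum c := by
    ext y
    have := FormalMultilinearSeries.ofScalars_sum_eq (E := ℝ) c y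
    simpa [Ssum, FormalMultilinearSeries.ofScalarsSum] using this
  rw [hs] at hf
  refine hf.analyticAt_of_mem ?_
  rw [Metric.mem_eball, edist_zero_right]
  refine lt_of_lt_of_le ?_ hr
  rw [enorm_eq_nnnorm]
  exact_mod_cast (show ‖x‖₊ < q from hq1)

open scoped ENNReal NNReal in
lemma exists_PS {B : ℝ → ℝ} (hB : AnalyticAt ℝ B 0) :
    ∃ c : ℕ → ℝ, ∃ R > 0, PS c R ∧ ∀ x, |x| < R → B x = Ssum c x := by
  obtain ⟨p, r, hr⟩ := hB
  obtain ⟨q, hq0, hq⟩ := ENNReal.lt_iff_exists_nnreal_btwn.1 hr.r_pos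
  refine ⟨p.coeff, q, by exact_mod_cast hq0, ?_, ?_⟩
  · intro s h0 h1
    lift s to ℝ≥0 using h0
    have hs : (s : ℝ≥0∞) < p.radius := by
      refine lt_of_lt_of_le ?_ hr.r_le
      refine lt_trans ?_ hq
      exact_mod_cast h1
    refine (p.summable_norm_mul_pow hs).congr (fun n => ?_)
    rw [FormalMultilinearSeries.norm_apply_eq_norm_coef]; rfl
  · intro x hx
    have hm : x ∈ Metric.eball (0:ℝ) r := by
      rw [Metric.mem_eball, edist_zero_right]
      refine lt_trans ?_ hq
      rw [enorm_eq_nnnorm]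
      exact_mod_cast (show ‖x‖₊ < q from hx)
    have := (hr.hasSum hm).tsum_eq
    rw [zero_add] at this
    rw [← this]
    simp [Ssum, mul_comm]

/-- Euler-type equation `s C + t C' = B`. -/
lemma exists_euler {B : ℝ → ℝ} (hB : AnalyticAt ℝ B 0) {s : ℝ} (hs : 0 < s) :
    ∃ C : ℝ → ℝ, AnalyticAt ℝ C 0 ∧
      ∀ᶠ t in nhds (0:ℝ), ∃ C', HasDerivAt C C' t ∧ s * C t + t * C' = B t := by
  obtain ⟨b, R, hR, hb, hB⟩ := exists_PS hB
  set c : ℕ → ℝ := fun n => b n / (s + n) with hc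
  have hcR : PS c R := by
    refine hb.of_le s⁻¹ (fun n => ?_)
    simp only [hc, abs_div]
    have h0 : (0:ℝ) ≤ n := n.cast_nonneg
    rw [abs_of_pos (by positivity : 0 < s + n), div_eq_inv_mul]
    gcongr
    linarith
  refine ⟨Ssum c, hcR.analyticAt (by simpa using hR), ?_⟩
  filter_upwards [Metric.ball_mem_nhds (0:ℝ) hR] with t ht
  have ht' : |t| < R := by simpa using ht
  refine ⟨_, hcR.hasDerivAt ht', ?_⟩
  rw [hB t ht', ← Ssum_theta hcR ht']
  unfold Ssum
  rw [← tsum_mul_left, ← ((hcR.summable ht').mul_left s).tsum_add (hcR.theta.summable ht')]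
  congr 1; ext n
  have h0 : (0:ℝ) < s + n := by positivity
  simp only [Tc, hc]; field_simp


/-- Near `0+`, `f = A + t^s B` with `A`, `B` analytic at `0`. -/
def Good (s : ℝ) (f : ℝ → ℝ) : Prop :=
  ∃ A B : ℝ → ℝ, AnalyticAt ℝ A 0 ∧ AnalyticAt ℝ B 0 ∧
    ∀ᶠ t in nhdsWithin (0:ℝ) (Ioi 0), f t = A t + t ^ s * B t

lemma Good.congr {s : ℝ} {f g : ℝ → ℝ} (h : Good s f)
    (hg : ∀ᶠ t in nhdsWithin (0:ℝ) (Ioi 0), g t = f t) : Good s g := by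
  obtain ⟨A, B, hA, hB, h⟩ := h
  refine ⟨A, B, hA, hB, ?_⟩
  filter_upwards [h, hg] with t h1 h2
  rw [h2, h1]

lemma Good.mul {s : ℝ} {f w : ℝ → ℝ} (h : Good s f) (hw : AnalyticAt ℝ w 0) :
    Good s (fun t => w t * f t) := by
  obtain ⟨A, B, hA, hB, h⟩ := h
  refine ⟨fun t => w t * A t, fun t => w t * B t, hw.mul hA, hw.mul hB, ?_⟩
  filter_upwards [h] with t h1
  rw [h1]; ring

lemma eventually_const {G : ℝ → ℝ}
    (h : ∀ᶠ t in nhdsWithin (0:ℝ) (Ioi 0), HasDerivAt G 0 t) :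
    ∃ k, ∀ᶠ t in nhdsWithin (0:ℝ) (Ioi 0), G t = k := by
  obtain ⟨u, hu, hs⟩ := mem_nhdsGT_iff_exists_Ioo_subset.1 h
  obtain ⟨k, hk⟩ := isOpen_Ioo.exists_is_const_of_deriv_eq_zero (f := G) (s := Ioo 0 u)
    isPreconnected_Ioo (fun x hx => (hs hx).differentiableAt.differentiableWithinAt)
    (fun x hx => (hs hx).deriv)
  refine ⟨k, ?_⟩
  filter_upwards [Ioo_mem_nhdsGT hu] with t ht using hk t ht

lemma Good.primitive {s : ℝ} (hs : -1 < s) {f F : ℝ → ℝ} (h : Good s f)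
    (hF : ∀ᶠ t in nhdsWithin (0:ℝ) (Ioi 0), HasDerivAt F (f t) t) : Good (s + 1) F := by
  obtain ⟨A, B, hA, hB, h⟩ := h
  obtain ⟨A1, hA1, eA⟩ := exists_euler hA (s := 1) one_pos
  obtain ⟨B1, hB1, eB⟩ := exists_euler hB (s := s + 1) (by linarith)
  obtain ⟨k, hk⟩ := eventually_const (G := fun t => F t - (t * A1 t + t ^ (s+1) * B1 t)) (by
    filter_upwards [h, hF, nhdsWithin_le_nhds eA, nhdsWithin_le_nhds eB, self_mem_nhdsWithin]
      with t h1 h2 ⟨a, ha, ha'⟩ ⟨b, hb, hb'⟩ ht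
    have ht : 0 < t := ht
    have d1 := (hasDerivAt_id t).mul ha
    have d2 := (Real.hasDerivAt_rpow_const (p := s + 1) (Or.inl ht.ne')).mul hb
    refine (h2.sub (d1.add d2)).congr_deriv ?_
    rw [h1, ← ha', ← hb']
    have e : t ^ (s + 1) = t ^ s * t := by rw [Real.rpow_add ht, Real.rpow_one]
    simp [e]; ring)
  refine ⟨fun t => k + t * A1 t, B1, analyticAt_const.add (analyticAt_id.mul hA1), hB1, ?_⟩
  filter_upwards [hk] with t ht
  linarith

lemma Pclass_add {α β : ℝ} {p : ℝ → ℝ} (hp : p ∈ Pclass α β) (a e : ℝ) (h1 : α < e)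
    (h2 : (¬ ∃ z : ℤ, e = (z:ℝ)) → β < e) : (fun t => p t + a * t ^ e) ∈ Pclass α β := by
  obtain ⟨n, b, f, hb1, hb2, hb3⟩ := hp
  refine ⟨n + 1, Fin.cons a b, Fin.cons e f, ?_, ?_, ?_⟩
  · intro i
    refine Fin.cases ?_ (fun i => ?_) i
    · intro _; simpa using h1
    · simpa using hb1 i
  · intro i
    refine Fin.cases ?_ (fun i => ?_) i
    · simpa using h2
    · simpa using hb2 i
  · intro t ht
    simp only [hb3 t ht]
    rw [Fin.sum_univ_succ]
    simp [add_comm]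

lemma Pclass_contDiffOn {α β : ℝ} {p : ℝ → ℝ} (hp : p ∈ Pclass α β) :
    ContDiffOn ℝ (⊤ : ℕ∞) p (Ioo (0:ℝ) 2) := by
  obtain ⟨n, b, f, -, -, h⟩ := hp
  refine ContDiffOn.congr ?_ h
  refine ContDiffOn.sum (fun i _ => ?_)
  refine contDiffOn_const.mul ?_
  intro t ht
  exact (Real.contDiffAt_rpow_const_of_ne ht.1.ne').contDiffWithinAt

lemma analytic_split {A : ℝ → ℝ} (hA : AnalyticAt ℝ A 0) :
    ∃ A1, AnalyticAt ℝ A1 0 ∧ ∀ t, A t = A 0 + t * A1 t := by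
  obtain ⟨p, hp⟩ := hA
  refine ⟨dslope A 0, ⟨_, hp.has_fpower_series_dslope_fslope⟩, fun t => ?_⟩
  have := sub_smul_dslope A 0 t
  simp at this
  linarith

lemma Good.expand {s β : ℝ} (hs : -1 < s) (hβ : β < s) {f : ℝ → ℝ} (h : Good s f) (N : ℕ) :
    ∃ p ∈ Pclass (-1) β, ∃ A B : ℝ → ℝ, AnalyticAt ℝ A 0 ∧ AnalyticAt ℝ B 0 ∧
      ∀ᶠ t in nhdsWithin (0:ℝ) (Ioi 0),
        f t = p t + (t ^ (N:ℝ) * A t + t ^ (s + N) * B t) := by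
  induction N with
  | zero =>
    obtain ⟨A, B, hA, hB, h⟩ := h
    refine ⟨fun _ => 0, ⟨0, Fin.elim0, Fin.elim0, fun i => i.elim0, fun i => i.elim0,
      fun t _ => by simp⟩, A, B, hA, hB, ?_⟩
    filter_upwards [h] with t ht
    simp [ht]
  | succ N ih =>
    obtain ⟨p, hp, A, B, hA, hB, h⟩ := ih
    obtain ⟨A1, hA1, eA⟩ := analytic_split hA
    obtain ⟨B1, hB1, eB⟩ := analytic_split hB
    have hN : (0:ℝ) ≤ N := N.cast_nonneg
    refine ⟨_, Pclass_add (Pclass_add hp (A 0) N (by linarith)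
      (fun hz => (hz ⟨N, by simp⟩).elim)) (B 0) (s + N) (by linarith)
      (fun _ => by linarith), A1, B1, hA1, hB1, ?_⟩
    filter_upwards [h, self_mem_nhdsWithin] with t ht h0
    have h0 : 0 < t := h0
    rw [ht, eA t, eB t]
    push_cast
    rw [← add_assoc s, Real.rpow_add h0 (N:ℝ) 1, Real.rpow_add h0 (s + N) 1, Real.rpow_one]
    ring

lemma iter_form {a b : ℝ} {r A B : ℝ → ℝ} (hA : AnalyticAt ℝ A 0) (hB : AnalyticAt ℝ B 0)
    (h : ∀ᶠ t in nhdsWithin (0:ℝ) (Ioi 0), r t = t ^ a * A t + t ^ b * B t) (m : ℕ) :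
    ∃ A B : ℝ → ℝ, AnalyticAt ℝ A 0 ∧ AnalyticAt ℝ B 0 ∧
      ∀ᶠ t in nhdsWithin (0:ℝ) (Ioi 0), iteratedDerivWithin m r (Ioo (0:ℝ) 2) t
        = t ^ (a - m) * A t + t ^ (b - m) * B t := by
  induction m with
  | zero => exact ⟨A, B, hA, hB, by simpa using h⟩
  | succ m ih =>
    obtain ⟨A, B, hA, hB, h⟩ := ih
    refine ⟨fun t => (a - m) * A t + t * deriv A t, fun t => (b - m) * B t + t * deriv B t,
      (analyticAt_const.mul hA).add (analyticAt_id.mul hA.deriv),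
      (analyticAt_const.mul hB).add (analyticAt_id.mul hB.deriv), ?_⟩
    have h' := eventually_eventually_nhdsWithin.2 h
    filter_upwards [h', nhdsWithin_le_nhds hA.eventually_analyticAt,
      nhdsWithin_le_nhds hB.eventually_analyticAt, Ioo_mem_nhdsGT (two_pos : (0:ℝ) < 2)]
      with t h1 hA1 hB1 ht
    have h0 : 0 < t := ht.1
    rw [nhdsWithin_eq_nhds.2 (Ioi_mem_nhds h0)] at h1
    rw [iteratedDerivWithin_succ, derivWithin_of_isOpen isOpen_Ioo ht, EventuallyEq.deriv_eq h1]
    have d1 := (Real.hasDerivAt_rpow_const (p := a - m) (Or.inl h0.ne')).mul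
      hA1.differentiableAt.hasDerivAt
    have d2 := (Real.hasDerivAt_rpow_const (p := b - m) (Or.inl h0.ne')).mul
      hB1.differentiableAt.hasDerivAt
    have := (d1.add d2).deriv
    refine Eq.trans this ?_
    have e : ∀ c : ℝ, t ^ (c - m) = t ^ (c - m - 1) * t := by
      intro c
      conv_lhs => rw [show c - m = (c - m - 1) + 1 by ring, Real.rpow_add h0, Real.rpow_one]
    push_cast
    rw [e a, e b, ← sub_sub, ← sub_sub]
    ring

lemma Good.mem_Q {s β : ℝ} (hs : -1 < s) (hβ : β < s) {f : ℝ → ℝ} (h : Good s f)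
    (hf : ContDiffOn ℝ (⊤ : ℕ∞) f (Ioo (0:ℝ) 2)) : f ∈ Qclass (-1) β := by
  intro γ
  obtain ⟨N, hN⟩ := exists_nat_ge (max γ (γ + 1))
  obtain ⟨p, hp, A, B, hA, hB, h⟩ := h.expand hs hβ N
  refine ⟨p, hp, fun t => f t - p t, ⟨hf.sub (Pclass_contDiffOn hp), fun m => ?_⟩,
    fun t _ => by ring⟩
  obtain ⟨A1, B1, hA1, hB1, h1⟩ := iter_form (a := N) (b := s + N) (r := fun t => f t - p t) hA hB (by
    filter_upwards [h] with t ht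
    rw [ht]; ring) m
  have bA := hA1.continuousAt.abs.eventually_lt_const (lt_add_one |A1 0|)
  have bB := hB1.continuousAt.abs.eventually_lt_const (lt_add_one |B1 0|)
  have hev : ∀ᶠ t in nhdsWithin (0:ℝ) (Ioi 0),
      |iteratedDerivWithin m (fun t => f t - p t) (Ioo (0:ℝ) 2) t| ≤
        ((|A1 0| + 1) + (|B1 0| + 1)) * t ^ (γ - m) := by
    filter_upwards [h1, nhdsWithin_le_nhds bA, nhdsWithin_le_nhds bB,
      Ioo_mem_nhdsGT (one_pos : (0:ℝ) < 1)] with t h2 h3 h4 ht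
    have h0 : 0 < t := ht.1
    have g1 : γ ≤ N := (le_max_left _ _).trans hN
    have g2 : γ + 1 ≤ N := (le_max_right _ _).trans hN
    have e1 : t ^ ((N:ℝ) - m) ≤ t ^ (γ - m) :=
      Real.rpow_le_rpow_of_exponent_ge h0 ht.2.le (by linarith)
    have e2 : t ^ (s + (N:ℝ) - m) ≤ t ^ (γ - m) :=
      Real.rpow_le_rpow_of_exponent_ge h0 ht.2.le (by linarith)
    rw [h2]
    refine (abs_add_le _ _).trans ?_
    rw [abs_mul, abs_mul, abs_of_pos (Real.rpow_pos_of_pos h0 _),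
      abs_of_pos (Real.rpow_pos_of_pos h0 _), add_mul, mul_comm, mul_comm (t ^ (s + (N:ℝ) - m))]
    have := Real.rpow_pos_of_pos h0 (γ - m)
    gcongr
  obtain ⟨u, hu, hsub⟩ := mem_nhdsGT_iff_exists_Ioo_subset.1 hev
  exact ⟨_, u, hu, fun t ht => hsub ⟨ht.1, ht.2.trans_le (min_le_left _ _)⟩⟩


/-- Coefficients of the mix term. -/
def cc (i j n : ℕ) : ℝ := uc i n * uc j n

lemma mixTerm_eq (i j : ℕ) : mixTerm i j = Ssum (cc i j) := rfl

lemma cc_PS (i j : ℕ) : PS (cc i j) 1 := by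
  obtain ⟨K, hK⟩ := uc_bdd i
  obtain ⟨L, hL⟩ := uc_bdd j
  have h1 : PS (fun _ => 1) 1 := by
    intro r h0 h1
    simpa using summable_geometric_of_lt_one h0 h1
  refine h1.of_le (K * L) (fun n => ?_)
  have : 0 ≤ K := (abs_nonneg _).trans (hK 0)
  simp only [cc, abs_mul, abs_one, mul_one]
  exact mul_le_mul (hK n) (hL n) (abs_nonneg _) this

lemma abs_one_sub_lt {t : ℝ} (ht : t ∈ Ioo (0:ℝ) 2) : |1 - t| < 1 := by
  rw [abs_lt]; constructor <;> linarith [ht.1, ht.2]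

lemma ev_Ioo : ∀ᶠ t in nhdsWithin (0:ℝ) (Ioi 0), t ∈ Ioo (0:ℝ) 1 := Ioo_mem_nhdsGT one_pos

lemma hasDerivAt_comp_one_sub {c : ℕ → ℝ} (hc : PS c 1) {t : ℝ} (ht : t ∈ Ioo (0:ℝ) 2) :
    HasDerivAt (fun t => Ssum c (1 - t)) (- Ssum (Dc c) (1 - t)) t := by
  have h := (hc.hasDerivAt (abs_one_sub_lt ht)).comp t ((hasDerivAt_id t).const_sub 1)
  exact h.congr_deriv (by simp)

lemma mix_contDiffOn (i j : ℕ) :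
    ContDiffOn ℝ (⊤ : ℕ∞) (fun t => mixTerm i j (1 - t)) (Ioo (0:ℝ) 2) := by
  intro t ht
  have h : AnalyticAt ℝ (mixTerm i j) (1 - t) := (cc_PS i j).analyticAt (abs_one_sub_lt ht)
  have h2 : ContDiffAt ℝ (⊤ : ℕ∞) (fun t : ℝ => 1 - t) t := by fun_prop
  exact (h.contDiffAt.comp t h2).contDiffWithinAt

lemma step_diag (i j : ℕ) {s : ℝ} (hs : -1 < s) (h : Good s (fun t => mixTerm i j (1 - t))) :
    Good (s + 1) (fun t => mixTerm (i+1) (j+1) (1 - t)) := by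
  refine (h.mul (w := fun _ => -1) analyticAt_const).primitive hs ?_
  filter_upwards [ev_Ioo] with t ht
  refine (hasDerivAt_comp_one_sub (cc_PS (i+1) (j+1)) ⟨ht.1, by linarith [ht.2]⟩).congr_deriv ?_
  have : Dc (cc (i+1) (j+1)) = cc i j := by
    ext n
    simp only [Dc, cc]
    rw [← uc_one i n, ← uc_one j n]
    have : Real.sqrt ((n:ℝ)+1) * Real.sqrt ((n:ℝ)+1) = n + 1 :=
      Real.mul_self_sqrt (by positivity)
    linear_combination (-(uc (i+1) (n+1) * uc (j+1) (n+1))) * this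
  rw [this, mixTerm_eq]; ring

lemma step_ode (i j : ℕ) {s : ℝ} (hs : -1 < s) (h : Good s (fun t => mixTerm i j (1 - t))) :
    Good (s + 1) (fun t => mixTerm i (j+2) (1 - t)) := by
  have hw : AnalyticAt ℝ (fun t : ℝ => ((1 - t) ^ (j + 3))⁻¹) 0 := by
    refine AnalyticAt.inv ?_ (by simp)
    exact (analyticAt_const.sub analyticAt_id).pow _
  have hw2 : AnalyticAt ℝ (fun t : ℝ => (1 - t) ^ (j + 2)) 0 :=
    (analyticAt_const.sub analyticAt_id).pow _
  have hp := (h.mul hw).primitive hs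
    (F := fun t => ((1 - t) ^ (j + 2))⁻¹ * mixTerm i (j+2) (1 - t)) (by
    filter_upwards [ev_Ioo] with t ht
    have ht2 : t ∈ Ioo (0:ℝ) 2 := ⟨ht.1, by linarith [ht.2]⟩
    have hne : (1 - t) ≠ 0 := by linarith [ht.2]
    have d1 := hasDerivAt_comp_one_sub (cc_PS i (j+2)) ht2
    have d2 := (((hasDerivAt_id t).const_sub 1).pow (j + 2)).inv (pow_ne_zero _ hne)
    have hode : mixTerm i j (1 - t) = ((j:ℝ)+2) * Ssum (cc i (j+2)) (1 - t)
        - (1 - t) * Ssum (Dc (cc i (j+2))) (1 - t) := by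
      rw [← Ssum_theta (cc_PS i (j+2)) (abs_one_sub_lt ht2), mixTerm_eq]
      unfold Ssum
      rw [← tsum_mul_left, ← (((cc_PS i (j+2)).summable (abs_one_sub_lt ht2)).mul_left _).tsum_sub
        ((cc_PS i (j+2)).theta.summable (abs_one_sub_lt ht2))]
      congr 1; ext n
      simp only [cc, Tc]
      rw [uc_two j n]; ring
    refine (d2.mul d1).congr_deriv ?_
    rw [hode]
    simp
    field_simp
    ring)
  refine (hp.mul hw2).congr ?_
  filter_upwards [ev_Ioo] with t ht
  have hne : (1 - t) ≠ 0 := by linarith [ht.2]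
  field_simp

lemma base_ode {x : ℝ} (hx : |x| < 1) :
    (1 - x^2) * Ssum (Dc (Dc (cc 0 0))) x = x * Ssum (Dc (cc 0 0)) x := by
  have hP := cc_PS 0 0
  have e1 : Dc (Dc (cc 0 0)) = Tc (Tc (cc 0 0)) := by
    ext n
    have h := uc_rec 0 n
    simp only [Dc, Tc, cc]
    push_cast
    have a1 : Real.sqrt ((n:ℝ)+1) ^ 2 = n + 1 := Real.sq_sqrt (by positivity)
    have a2 : Real.sqrt ((n:ℝ)+2) ^ 2 = n + 2 := Real.sq_sqrt (by positivity)
    have h2 := congrArg (fun y => y ^ 2) h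
    simp only [mul_pow, a1, a2] at h2
    push_cast at h2
    have e : n + 1 + 1 = n + 2 := rfl
    rw [e]
    linear_combination h2
  have e2 : Dc (Tc (cc 0 0)) = fun n => Dc (cc 0 0) n + Tc (Dc (cc 0 0)) n := by
    ext n; simp only [Dc, Tc]; push_cast; ring
  have h1 : Ssum (Tc (Tc (cc 0 0))) x = x * Ssum (Dc (Tc (cc 0 0))) x := Ssum_theta hP.theta hx
  have h2 : Ssum (Dc (Tc (cc 0 0))) x = Ssum (Dc (cc 0 0)) x + x * Ssum (Dc (Dc (cc 0 0))) x := by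
    rw [e2, ← Ssum_theta hP.deriv_coeff hx]
    unfold Ssum
    rw [← (hP.deriv_coeff.summable hx).tsum_add (hP.deriv_coeff.theta.summable hx)]
    congr 1; ext n; ring
  rw [h2, ← e1] at h1
  linear_combination h1

lemma base_good : Good (1/2) (fun t => mixTerm 0 0 (1 - t)) := by
  have hP := cc_PS 0 0
  -- `g(1-t) * sqrt (t (2-t))` is constant
  obtain ⟨k, hk⟩ := eventually_const
    (G := fun t => Ssum (Dc (cc 0 0)) (1 - t) * (t ^ (1/2:ℝ) * (2 - t) ^ (1/2:ℝ))) (by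
    filter_upwards [ev_Ioo] with t ht
    have h0 : 0 < t := ht.1
    have h2 : 0 < 2 - t := by linarith [ht.2]
    have ht2 : t ∈ Ioo (0:ℝ) 2 := ⟨ht.1, by linarith [ht.2]⟩
    have d1 := hasDerivAt_comp_one_sub hP.deriv_coeff ht2
    have d2 := Real.hasDerivAt_rpow_const (x := t) (p := 1/2) (Or.inl h0.ne')
    have d3 := ((hasDerivAt_id t).const_sub 2).rpow_const (p := 1/2) (Or.inl h2.ne')
    refine (d1.mul (d2.mul d3)).congr_deriv ?_
    have ho := base_ode (abs_one_sub_lt ht2)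
    have ea : t ^ (1/2:ℝ) = t ^ (1/2 - 1 : ℝ) * t := by
      conv_lhs => rw [show (1/2:ℝ) = (1/2 - 1) + 1 by ring, Real.rpow_add h0, Real.rpow_one]
    have eb : (2 - t) ^ (1/2:ℝ) = (2 - t) ^ (1/2 - 1 : ℝ) * (2 - t) := by
      conv_lhs => rw [show (1/2:ℝ) = (1/2 - 1) + 1 by ring, Real.rpow_add h2, Real.rpow_one]
    simp only [id, Pi.mul_apply]
    rw [ea, eb]
    linear_combination (-(t ^ (1/2 - 1 : ℝ) * (2 - t) ^ (1/2 - 1 : ℝ))) * ho)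
  have hw : AnalyticAt ℝ (fun t : ℝ => -k * (2 - t) ^ (-(1/2):ℝ)) 0 := by
    refine analyticAt_const.mul ?_
    have h2 : AnalyticAt ℝ (fun t : ℝ => 2 - t) 0 := analyticAt_const.sub analyticAt_id
    have h3 : AnalyticAt ℝ (fun t : ℝ => Real.exp (Real.log (2 - t) * (-(1/2):ℝ))) 0 :=
      ((h2.log (by norm_num)).mul analyticAt_const).rexp'
    refine h3.congr ?_
    have h4 : ∀ᶠ t : ℝ in nhds 0, t < 2 := eventually_lt_nhds (by norm_num)
    filter_upwards [h4] with t ht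
    rw [Real.rpow_def_of_pos (by linarith)]
  have hg : Good (-(1/2)) (fun t => - Ssum (Dc (cc 0 0)) (1 - t)) := by
    refine ⟨fun _ => 0, _, analyticAt_const, hw, ?_⟩
    filter_upwards [hk, ev_Ioo] with t hkt ht
    have h0 : 0 < t := ht.1
    have h2 : 0 < 2 - t := by linarith [ht.2]
    rw [← hkt, Real.rpow_neg h0.le, Real.rpow_neg h2.le]
    have := Real.rpow_pos_of_pos h0 (1/2)
    have := Real.rpow_pos_of_pos h2 (1/2)
    field_simp
    ring
  have := hg.primitive (by norm_num) (F := fun t => mixTerm 0 0 (1 - t)) (by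
    filter_upwards [ev_Ioo] with t ht
    exact hasDerivAt_comp_one_sub hP ⟨ht.1, by linarith [ht.2]⟩)
  norm_num at this
  norm_num
  exact this

lemma good_zero (k : ℕ) : Good (k + 1/2) (fun t => mixTerm 0 (2 * k) (1 - t)) := by
  induction k with
  | zero => simpa using base_good
  | succ k ih =>
    have h0 : (0:ℝ) ≤ k := k.cast_nonneg
    have := step_ode 0 (2 * k) (by linarith) ih
    have e : ((k + 1 : ℕ) : ℝ) + 1/2 = k + 1/2 + 1 := by push_cast; ring
    rw [e]; exact this

lemma good_le (k i : ℕ) : Good (k + i + 1/2) (fun t => mixTerm i (i + 2 * k) (1 - t)) := by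
  induction i with
  | zero => simpa using good_zero k
  | succ i ih =>
    have h0 : (0:ℝ) ≤ k := k.cast_nonneg
    have h1 : (0:ℝ) ≤ i := i.cast_nonneg
    have := step_diag i (i + 2 * k) (by linarith) ih
    have e : (k:ℝ) + ((i + 1 : ℕ) : ℝ) + 1/2 = k + i + 1/2 + 1 := by push_cast; ring
    have e2 : i + 1 + 2 * k = i + 2 * k + 1 := by ring
    rw [e, e2]; exact this

lemma mix_symm (i j : ℕ) : mixTerm i j = mixTerm j i := by
  rw [mixTerm_eq, mixTerm_eq]; congr 1; ext n; simp only [cc]; ring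

lemma good_even (i j : ℕ) (h : Even (i + j)) :
    Good (((i:ℝ) + j) / 2 + 1/2) (fun t => mixTerm i j (1 - t)) := by
  have key : ∀ i j : ℕ, Even (i + j) → i ≤ j →
      Good (((i:ℝ) + j) / 2 + 1/2) (fun t => mixTerm i j (1 - t)) := by
    intro i j h hij
    obtain ⟨m, hm⟩ := h
    obtain ⟨k, rfl⟩ : ∃ k, j = i + 2 * k := ⟨m - i, by omega⟩
    have := good_le k i
    have e : ((i:ℝ) + ((i + 2 * k : ℕ) : ℝ)) / 2 + 1/2 = k + i + 1/2 := by push_cast; ring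
    rw [e]; exact this
  rcases le_total i j with hij | hij
  · exact key i j h hij
  · have := key j i (by rwa [add_comm]) hij
    rw [mix_symm, add_comm (i:ℝ)]; exact this

lemma mix_neg (i j : ℕ) (x : ℝ) : mixTerm i j (-x) = (-1) ^ (i + 1) * mixTerm i j x := by
  rw [mixTerm_eq]; unfold Ssum
  rw [← tsum_mul_left]
  congr 1; ext n
  by_cases h : Even (i + n)
  · simp [cc, uc_parity i n h]
  · have h2 : Even (i + 1 + n) := by
      rw [Nat.not_even_iff_odd] at h
      have := h.add_one
      rwa [show i + n + 1 = i + 1 + n by ring] at this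
    have h3 : ((-1:ℝ)) ^ (i+1) * (-1) ^ n = 1 := by rw [← pow_add]; exact h2.neg_one_pow
    have h4 : ((-1:ℝ)) ^ (i+1) * (-1) ^ (i+1) = 1 := by rw [← mul_pow]; simp
    have h5 : ((-1:ℝ)) ^ n = (-1) ^ (i+1) := by
      linear_combination (-1:ℝ)^(i+1) * h3 - (-1:ℝ)^n * h4
    rw [neg_pow, h5]; ring

lemma mix_odd (i j : ℕ) (h : ¬ Even (i + j)) (x : ℝ) : mixTerm i j x = 0 := by
  rw [mixTerm_eq]; unfold Ssum
  convert tsum_zero with n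
  by_cases h1 : Even (i + n)
  · simp [cc, uc_parity i n h1]
  · have h2 : Even (j + n) := by
      rw [Nat.even_iff] at *; omega
    simp [cc, uc_parity j n h2]

/-- boundary behavior of the mix terms:
`t ↦ f_{i,j}(τ(1−t))` belongs to `Q_{−1,(i+j)/2}`. -/
theorem mixTerm_boundary (i j : ℕ) (τ : ℝ) (hτ : τ = 1 ∨ τ = -1) :
    (fun t : ℝ => mixTerm i j (τ * (1 - t))) ∈ Qclass (-1) (((i : ℝ) + j) / 2) := by
  have hnn : (0:ℝ) ≤ ((i:ℝ) + j) / 2 := by positivity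
  have hgood : ∃ s, -1 < s ∧ ((i:ℝ) + j) / 2 < s ∧ Good s (fun t => mixTerm i j (1 - t)) := by
    refine ⟨((i:ℝ) + j) / 2 + 1/2, by linarith, by linarith, ?_⟩
    by_cases h : Even (i + j)
    · exact good_even i j h
    · refine ⟨fun _ => 0, fun _ => 0, analyticAt_const, analyticAt_const,
        Eventually.of_forall fun t => ?_⟩
      simp [mix_odd i j h]
  obtain ⟨s, hs1, hs2, hg⟩ := hgood
  rcases hτ with rfl | rfl
  · simpa using hg.mem_Q hs1 hs2 (mix_contDiffOn i j)
  · have e : (fun t : ℝ => mixTerm i j (-1 * (1 - t)))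
        = fun t => (-1) ^ (i + 1) * mixTerm i j (1 - t) := by
      ext t
      rw [neg_one_mul, mix_neg]
    rw [e]
    exact (hg.mul (w := fun _ => (-1) ^ (i + 1)) analyticAt_const).mem_Q hs1 hs2
      (contDiffOn_const.mul (mix_contDiffOn i j))
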